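/- Let n, r, t be integers with t ≥ 1 and n ≥ 2r+2t+2, let K_n = (V,E) be the complete graph, set p = t/C(n−2r,2), and define y : P_{r+1} → ℝ by y_A = Pr_{D_p}[X_q = 1 for all q ∈ A]. Then the symmetric matrix M, indexed by subsets A, B ⊆ V∪E of size at most 1, with entries M_{A,B} = y_{A∪B}, is positive semidefinite. Consequently y lies in the level-r SA+ tightening of P_t(K_n) (the level-r Sherali–Adams tightening with the additional requirement that this leading principal minor of the moment matrix be PSD), its objective is ∑_{i∈V} y_{{i}} = t·n/C(n−2r,2), and the integrality gap of the level-r SA+ tightening of the t-PVC LP on n-vertex graphs is at least C(n−2r,2)/(t·n). -/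

import Mathlib

open Finset
open scoped Classical

noncomputable section

/-- The edges of the complete graph `K_n`: non-diagonal unordered pairs of `Fin n`. -/
abbrev EdgeT (n : ℕ) : Type := {e : Sym2 (Fin n) // ¬ e.IsDiag}

/-- The LP variables of the `t`-PVC relaxation on `K_n`: vertices ⊕ edges. -/
abbrev PVar (n : ℕ) : Type := Fin n ⊕ EdgeT n

/-- The 0-1 assignment determined by a set `S` of chosen vertices: a vertex variable is 1
iff the vertex is chosen, an edge variable is 1 iff the edge has a chosen endpoint. -/
def Xvar (n : ℕ) (q : PVar n) (S : Finset (Fin n)) : ℝ :=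
  match q with
  | Sum.inl i => if i ∈ S then 1 else 0
  | Sum.inr e => if ∃ i ∈ S, i ∈ e.1 then 1 else 0

/-- The probability, under the distribution `D_p` (each vertex chosen independently with
probability `p`), of the set of chosen vertices being exactly `S`. -/
def μD (n : ℕ) (p : ℝ) (S : Finset (Fin n)) : ℝ :=
  p ^ S.card * (1 - p) ^ (n - S.card)

/-- Expectation with respect to `D_p`. -/
def ED (n : ℕ) (p : ℝ) (f : Finset (Fin n) → ℝ) : ℝ :=
  ∑ S : Finset (Fin n), μD n p S * f S

/-- `y_A = Pr_{D_p}[X_q = 1 for all q ∈ A]`. -/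
def yD (n : ℕ) (p : ℝ) (A : Finset (PVar n)) : ℝ :=
  ∑ S : Finset (Fin n), if ∀ q ∈ A, Xvar n q S = 1 then μD n p S else 0

/-- The value `p = t / C(n - 2r, 2)`. -/
def pval (n r t : ℕ) : ℝ := (t : ℝ) / (Nat.choose (n - 2 * r) 2)

/-- The linearization `w_{Y,N} = ∑_{T ⊆ N} (-1)^{|T|} y_{Y ∪ T}`. -/
def wSA {α : Type*} [DecidableEq α] (y : Finset α → ℝ) (Y N : Finset α) : ℝ :=
  ∑ T ∈ N.powerset, (-1 : ℝ) ^ T.card * y (Y ∪ T)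

/-- Membership of `y` in the level-`r` Sherali–Adams tightening `S^{(r)}(P_t(K_n))` of
the `t`-partial-vertex-cover polytope of the complete graph `K_n`. -/
def SAmem (n t r : ℕ) (y : Finset (PVar n) → ℝ) : Prop :=
  y ∅ = 1 ∧
  ∀ Y N : Finset (PVar n), (Y ∪ N).card ≤ r →
    (∀ (e : EdgeT n) (i j : Fin n), e.1 = s(i, j) →
      wSA y (Y ∪ {Sum.inl i}) N + wSA y (Y ∪ {Sum.inl j}) N
        ≥ wSA y (Y ∪ {Sum.inr e}) N) ∧
    ((∑ e : EdgeT n, wSA y (Y ∪ {Sum.inr e}) N) ≥ (t : ℝ) * wSA y Y N) ∧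
    (∀ q : PVar n, 0 ≤ wSA y (Y ∪ {q}) N ∧ wSA y (Y ∪ {q}) N ≤ wSA y Y N)

/-- The number of edges of `K_n` covered by (i.e. incident to) the vertex set `S`. -/
def covered (n : ℕ) (S : Finset (Fin n)) : ℕ :=
  (Finset.univ.filter (fun e : EdgeT n => ∃ i ∈ S, i ∈ e.1)).card

lemma Xvar_eq_zero_or_one (n : ℕ) (q : PVar n) (S : Finset (Fin n)) :
    Xvar n q S = 0 ∨ Xvar n q S = 1 := by
  rcases q with i | e <;> simp only [Xvar] <;> split_ifs <;> simp

lemma Xvar_nonneg (n : ℕ) (q : PVar n) (S : Finset (Fin n)) : 0 ≤ Xvar n q S := by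
  rcases Xvar_eq_zero_or_one n q S with h | h <;> simp [h]

lemma Xvar_le_one (n : ℕ) (q : PVar n) (S : Finset (Fin n)) : Xvar n q S ≤ 1 := by
  rcases Xvar_eq_zero_or_one n q S with h | h <;> simp [h]

lemma Xvar_inl_le_inr {n : ℕ} {i : Fin n} {e : EdgeT n} (hi : i ∈ e.1) (S : Finset (Fin n)) :
    Xvar n (Sum.inl i) S ≤ Xvar n (Sum.inr e) S := by
  by_cases h : i ∈ S
  · have h' : ∃ k ∈ S, k ∈ e.1 := ⟨i, h, hi⟩
    simp only [Xvar, if_pos h, if_pos h', le_refl]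
  · simpa only [Xvar, if_neg h] using Xvar_nonneg n (Sum.inr e) S

lemma Xvar_inr_le_add {n : ℕ} {i j : Fin n} {e : EdgeT n} (he : e.1 = s(i, j))
    (S : Finset (Fin n)) :
    Xvar n (Sum.inr e) S ≤ Xvar n (Sum.inl i) S + Xvar n (Sum.inl j) S := by
  by_cases h : ∃ k ∈ S, k ∈ e.1
  · obtain ⟨k, hk, hke⟩ := h
    rw [he, Sym2.mem_iff] at hke
    have h1 := Xvar_le_one n (Sum.inr e) S
    rcases hke with rfl | rfl
    · have h2 : Xvar n (Sum.inl k) S = 1 := by simp [Xvar, hk]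
      have h3 := Xvar_nonneg n (Sum.inl j) S
      linarith
    · have h2 : Xvar n (Sum.inl k) S = 1 := by simp [Xvar, hk]
      have h3 := Xvar_nonneg n (Sum.inl i) S
      linarith
  · have h2 : Xvar n (Sum.inr e) S = 0 := by simp only [Xvar, if_neg h]
    have h3 := Xvar_nonneg n (Sum.inl i) S
    have h4 := Xvar_nonneg n (Sum.inl j) S
    linarith

lemma prod_Xvar_eq_ite (n : ℕ) (A : Finset (PVar n)) (S : Finset (Fin n)) :
    ∏ q ∈ A, Xvar n q S = if ∀ q ∈ A, Xvar n q S = 1 then 1 else 0 := by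
  split_ifs with h
  · exact Finset.prod_eq_one h
  · push Not at h
    obtain ⟨q, hq, hq1⟩ := h
    exact Finset.prod_eq_zero hq ((Xvar_eq_zero_or_one n q S).resolve_right hq1)

lemma prod_Xvar_union (n : ℕ) (A B : Finset (PVar n)) (S : Finset (Fin n)) :
    ∏ q ∈ A ∪ B, Xvar n q S = (∏ q ∈ A, Xvar n q S) * ∏ q ∈ B, Xvar n q S := by
  simp only [prod_Xvar_eq_ite, Finset.mem_union, or_imp, forall_and]
  split_ifs <;> simp_all

lemma yD_eq_ED (n : ℕ) (p : ℝ) (A : Finset (PVar n)) :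
    yD n p A = ED n p fun S => ∏ q ∈ A, Xvar n q S := by
  simp [yD, ED, prod_Xvar_eq_ite]

/-- The indicator that all variables in `Y` are `1` and all variables in `N` are `0`. -/
def patternInd (n : ℕ) (Y N : Finset (PVar n)) (S : Finset (Fin n)) : ℝ :=
  (∏ q ∈ Y, Xvar n q S) * ∏ q ∈ N, (1 - Xvar n q S)

lemma patternInd_nonneg (n : ℕ) (Y N : Finset (PVar n)) (S : Finset (Fin n)) :
    0 ≤ patternInd n Y N S :=
  mul_nonneg (Finset.prod_nonneg fun q _ => Xvar_nonneg n q S)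
    (Finset.prod_nonneg fun q _ => sub_nonneg.2 (Xvar_le_one n q S))

lemma patternInd_union_singleton (n : ℕ) (Y N : Finset (PVar n)) (q : PVar n)
    (S : Finset (Fin n)) :
    patternInd n (Y ∪ {q}) N S = Xvar n q S * patternInd n Y N S := by
  rw [patternInd, patternInd, prod_Xvar_union, Finset.prod_singleton]
  ring

lemma wSA_yD (n : ℕ) (p : ℝ) (Y N : Finset (PVar n)) :
    wSA (yD n p) Y N = ED n p (patternInd n Y N) := by
  have h (S : Finset (Fin n)) : ∏ q ∈ N, (1 - Xvar n q S)
      = ∑ T ∈ N.powerset, (-1 : ℝ) ^ T.card * ∏ q ∈ T, Xvar n q S := by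
    simp only [sub_eq_add_neg, Finset.prod_one_add, Finset.prod_neg]
  simp only [wSA, yD_eq_ED, ED, patternInd, prod_Xvar_union, h, Finset.mul_sum]
  rw [Finset.sum_comm]
  exact Finset.sum_congr rfl fun S _ => Finset.sum_congr rfl fun T _ => by ring

lemma μD_nonneg {n : ℕ} {p : ℝ} (h0 : 0 ≤ p) (h1 : p ≤ 1) (S : Finset (Fin n)) :
    0 ≤ μD n p S :=
  mul_nonneg (pow_nonneg h0 _) (pow_nonneg (sub_nonneg.2 h1) _)

lemma ED_mono {n : ℕ} {p : ℝ} (h0 : 0 ≤ p) (h1 : p ≤ 1) {f g : Finset (Fin n) → ℝ}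
    (h : ∀ S, f S ≤ g S) : ED n p f ≤ ED n p g :=
  Finset.sum_le_sum fun S _ => mul_le_mul_of_nonneg_left (h S) (μD_nonneg h0 h1 S)

lemma ED_add (n : ℕ) (p : ℝ) (f g : Finset (Fin n) → ℝ) :
    ED n p (fun S => f S + g S) = ED n p f + ED n p g := by
  simp [ED, mul_add, Finset.sum_add_distrib]

lemma ED_one (n : ℕ) (p : ℝ) : ED n p (fun _ => 1) = 1 := by
  have h := Finset.sum_pow_mul_eq_add_pow p (1 - p) (Finset.univ : Finset (Fin n))
  simpa [ED, μD] using h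

lemma sum_finset_eq_sum_powerset_erase {n : ℕ} (i : Fin n) (F : Finset (Fin n) → ℝ) :
    ∑ S : Finset (Fin n), F S
      = ∑ S ∈ (Finset.univ.erase i).powerset, (F S + F (insert i S)) := by
  rw [Finset.sum_add_distrib, ← Finset.sum_powerset_insert (Finset.notMem_erase i _),
    Finset.insert_erase (Finset.mem_univ i), Finset.powerset_univ]

/-- A vertex variable is independent of any function of the other vertices. -/
lemma ED_Xvar_inl_mul {n : ℕ} (p : ℝ) (i : Fin n) {f : Finset (Fin n) → ℝ}
    (hf : ∀ S, f (insert i S) = f S) :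
    ED n p (fun S => Xvar n (Sum.inl i) S * f S) = p * ED n p f := by
  simp only [ED]
  rw [sum_finset_eq_sum_powerset_erase i, sum_finset_eq_sum_powerset_erase i, Finset.mul_sum]
  refine Finset.sum_congr rfl fun S hS => ?_
  have hi : i ∉ S := fun h => Finset.notMem_erase i _ (Finset.mem_powerset.1 hS h)
  have hc : (insert i S).card = S.card + 1 := Finset.card_insert_of_notMem hi
  have hle : S.card + 1 ≤ n := by
    simpa [hc] using Finset.card_le_univ (insert i S)
  obtain ⟨k, hk⟩ := Nat.exists_eq_add_of_le hle
  have e1 : n - S.card = k + 1 := by omega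
  have e2 : n - (S.card + 1) = k := by omega
  simp only [Xvar, μD, hc, e1, e2, hf, hi, Finset.mem_insert_self, if_true, if_false]
  ring

lemma yD_singleton_inl (n : ℕ) (p : ℝ) (i : Fin n) : yD n p {Sum.inl i} = p := by
  have h := ED_Xvar_inl_mul p i (f := fun _ => 1) fun _ => rfl
  rw [ED_one, mul_one] at h
  simpa [yD_eq_ED] using h

/-- The vertices on which an LP variable depends. -/
def varSupport (n : ℕ) : PVar n → Finset (Fin n)
  | Sum.inl i => {i}
  | Sum.inr e => e.1.toFinset

lemma card_varSupport_le (n : ℕ) (q : PVar n) : (varSupport n q).card ≤ 2 := by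
  rcases q with i | e
  · simp [varSupport]
  · exact (Sym2.card_toFinset_of_not_isDiag e.1 e.2).le

lemma Xvar_insert {n : ℕ} {q : PVar n} {i : Fin n} (hi : i ∉ varSupport n q)
    (S : Finset (Fin n)) : Xvar n q (insert i S) = Xvar n q S := by
  rcases q with j | e
  · have : j ≠ i := fun h => hi (by simp [varSupport, h])
    simp [Xvar, this]
  · have : i ∉ e.1 := fun h => hi (by simpa [varSupport] using h)
    simp [Xvar, this]

lemma patternInd_insert {n : ℕ} {Y N : Finset (PVar n)} {i : Fin n}
    (hi : i ∉ (Y ∪ N).biUnion (varSupport n)) (S : Finset (Fin n)) :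
    patternInd n Y N (insert i S) = patternInd n Y N S := by
  have h (q : PVar n) (hq : q ∈ Y ∪ N) : i ∉ varSupport n q := fun hq' =>
    hi (Finset.mem_biUnion.2 ⟨q, hq, hq'⟩)
  unfold patternInd
  congr 1
  · exact Finset.prod_congr rfl fun q hq => Xvar_insert (h q (Finset.mem_union_left _ hq)) S
  · exact Finset.prod_congr rfl fun q hq => by
      rw [Xvar_insert (h q (Finset.mem_union_right _ hq)) S]

lemma choose_card_le_card_edges {n : ℕ} (W : Finset (Fin n)) :
    W.card.choose 2 ≤ (Finset.univ.filter fun e : EdgeT n => ∃ i ∈ W, i ∈ e.1).card := by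
  rw [← Sym2.card_image_offDiag]
  refine le_trans (Finset.card_le_card ?_) (Finset.card_image_le (f := Subtype.val))
  intro e he
  obtain ⟨⟨a, b⟩, hab, rfl⟩ := Finset.mem_image.1 he
  rw [Finset.mem_offDiag] at hab
  refine Finset.mem_image.2 ⟨⟨s(a, b), by simpa using hab.2.2⟩, ?_, rfl⟩
  exact Finset.mem_filter.2 ⟨Finset.mem_univ _, a, hab.1, Sym2.mem_mk_left a b⟩

lemma choose_mul_le_sum_wSA {n r : ℕ} {p : ℝ} (h0 : 0 ≤ p) (h1 : p ≤ 1)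
    {Y N : Finset (PVar n)} (hr : (Y ∪ N).card ≤ r) :
    ((n - 2 * r).choose 2 : ℝ) * (p * wSA (yD n p) Y N)
      ≤ ∑ e : EdgeT n, wSA (yD n p) (Y ∪ {Sum.inr e}) N := by
  simp only [wSA_yD]
  set U := (Y ∪ N).biUnion (varSupport n) with hU
  have hUc : U.card ≤ r * 2 :=
    (Finset.card_biUnion_le_card_mul _ _ 2 fun q _ => card_varSupport_le n q).trans
      (Nat.mul_le_mul_right 2 hr)
  have hcard : (n - 2 * r).choose 2
      ≤ (Finset.univ.filter fun e : EdgeT n => ∃ i ∈ Uᶜ, i ∈ e.1).card := by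
    refine (Nat.choose_le_choose 2 ?_).trans (choose_card_le_card_edges Uᶜ)
    rw [Finset.card_compl, Fintype.card_fin]
    omega
  have hE : 0 ≤ ED n p (patternInd n Y N) :=
    Finset.sum_nonneg fun S _ => mul_nonneg (μD_nonneg h0 h1 S) (patternInd_nonneg n Y N S)
  have hnonneg (e : EdgeT n) : 0 ≤ ED n p (patternInd n (Y ∪ {Sum.inr e}) N) :=
    Finset.sum_nonneg fun S _ => mul_nonneg (μD_nonneg h0 h1 S) (patternInd_nonneg n _ N S)
  calc ((n - 2 * r).choose 2 : ℝ) * (p * ED n p (patternInd n Y N))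
      ≤ ((Finset.univ.filter fun e : EdgeT n => ∃ i ∈ Uᶜ, i ∈ e.1).card : ℝ)
          * (p * ED n p (patternInd n Y N)) :=
        mul_le_mul_of_nonneg_right (by exact_mod_cast hcard) (mul_nonneg h0 hE)
    _ = ∑ _e ∈ Finset.univ.filter fun e : EdgeT n => ∃ i ∈ Uᶜ, i ∈ e.1,
          p * ED n p (patternInd n Y N) := by
        rw [Finset.sum_const, nsmul_eq_mul]
    _ ≤ ∑ e ∈ Finset.univ.filter fun e : EdgeT n => ∃ i ∈ Uᶜ, i ∈ e.1,
          ED n p (patternInd n (Y ∪ {Sum.inr e}) N) := by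
        refine Finset.sum_le_sum fun e he => ?_
        obtain ⟨i, hi, hie⟩ := (Finset.mem_filter.1 he).2
        rw [← ED_Xvar_inl_mul p i (patternInd_insert (Finset.mem_compl.1 hi))]
        refine ED_mono h0 h1 fun S => ?_
        rw [patternInd_union_singleton]
        exact mul_le_mul_of_nonneg_right (Xvar_inl_le_inr hie S) (patternInd_nonneg n Y N S)
    _ ≤ ∑ e : EdgeT n, ED n p (patternInd n (Y ∪ {Sum.inr e}) N) :=
        Finset.sum_le_sum_of_subset_of_nonneg (Finset.filter_subset _ _) fun e _ _ => hnonneg e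

lemma posSemidef_moment {n : ℕ} {p : ℝ} (h0 : 0 ≤ p) (h1 : p ≤ 1) :
    Matrix.PosSemidef (Matrix.of fun A B : {A : Finset (PVar n) // A.card ≤ 1} =>
      yD n p (A.1 ∪ B.1)) := by
  let R : Matrix (Finset (Fin n)) {A : Finset (PVar n) // A.card ≤ 1} ℝ :=
    Matrix.of fun S A => √(μD n p S) * ∏ q ∈ A.1, Xvar n q S
  convert Matrix.posSemidef_conjTranspose_mul_self R using 1
  ext A B
  simp only [Matrix.mul_apply, Matrix.conjTranspose_apply, R, Matrix.of_apply, star_trivial,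
    yD_eq_ED, prod_Xvar_union, ED]
  refine Finset.sum_congr rfl fun S _ => ?_
  nth_rewrite 1 [← Real.mul_self_sqrt (μD_nonneg h0 h1 S)]
  ring

lemma SAmem_yD {n r t : ℕ} {p : ℝ} (h0 : 0 ≤ p) (h1 : p ≤ 1)
    (ht : (t : ℝ) ≤ (n - 2 * r).choose 2 * p) : SAmem n t r (yD n p) := by
  refine ⟨by simp [yD_eq_ED, ED_one], fun Y N hr => ⟨fun e i j he => ?_, ?_, fun q => ?_⟩⟩
  · simp only [wSA_yD]
    rw [ge_iff_le, ← ED_add]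
    refine ED_mono h0 h1 fun S => ?_
    simp only [patternInd_union_singleton, ← add_mul]
    exact mul_le_mul_of_nonneg_right (Xvar_inr_le_add he S) (patternInd_nonneg n Y N S)
  · refine le_trans ?_ (choose_mul_le_sum_wSA h0 h1 hr)
    rw [← mul_assoc, wSA_yD]
    exact mul_le_mul_of_nonneg_right ht (Finset.sum_nonneg fun S _ =>
      mul_nonneg (μD_nonneg h0 h1 S) (patternInd_nonneg n Y N S))
  · simp only [wSA_yD]
    refine ⟨Finset.sum_nonneg fun S _ =>
      mul_nonneg (μD_nonneg h0 h1 S) (patternInd_nonneg n _ N S), ED_mono h0 h1 fun S => ?_⟩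
    rw [patternInd_union_singleton]
    exact mul_le_of_le_one_left (patternInd_nonneg n Y N S) (Xvar_le_one n q S)

lemma le_choose_two {m t : ℕ} (h : t + 2 ≤ m) : t ≤ m.choose 2 := by
  obtain ⟨k, rfl⟩ : ∃ k, m = k + 1 := ⟨m - 1, by omega⟩
  rw [Nat.choose_succ_succ' k 1, Nat.choose_one_right]
  omega

theorem stmt8 (n r t : ℕ) (ht : 1 ≤ t) (hn : 2 * r + 2 * t + 2 ≤ n) :
    Matrix.PosSemidef (Matrix.of fun A B : {A : Finset (PVar n) // A.card ≤ 1} =>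
      yD n (pval n r t) (A.1 ∪ B.1)) ∧
    SAmem n t r (yD n (pval n r t)) ∧
    (∑ i : Fin n, yD n (pval n r t) {Sum.inl i})
      = (t : ℝ) * n / (Nat.choose (n - 2 * r) 2) ∧
    (∀ S : Finset (Fin n), t ≤ covered n S →
      ((Nat.choose (n - 2 * r) 2 : ℝ)) / ((t : ℝ) * n)
        ≤ (S.card : ℝ) / (∑ i : Fin n, yD n (pval n r t) {Sum.inl i})) := by
  have hC : t ≤ (n - 2 * r).choose 2 := le_choose_two (by omega)
  have htR : (0 : ℝ) < t := by exact_mod_cast ht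
  have hCR : (t : ℝ) ≤ (n - 2 * r).choose 2 := by exact_mod_cast hC
  have hC0 : (0 : ℝ) < (n - 2 * r).choose 2 := htR.trans_le hCR
  have hn0 : (0 : ℝ) < n := by exact_mod_cast (show 0 < n by omega)
  have h0 : 0 ≤ pval n r t := div_nonneg htR.le hC0.le
  have h1 : pval n r t ≤ 1 := (div_le_one hC0).2 hCR
  have hobj : (∑ i : Fin n, yD n (pval n r t) {Sum.inl i})
      = (t : ℝ) * n / (Nat.choose (n - 2 * r) 2) := by
    simp only [yD_singleton_inl, pval, Finset.sum_const, Finset.card_univ, Fintype.card_fin,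
      nsmul_eq_mul]
    ring
  refine ⟨posSemidef_moment h0 h1, SAmem_yD h0 h1 ?_, hobj, fun S hS => ?_⟩
  · rw [pval, mul_div_cancel₀ _ hC0.ne']
  · have hS1 : 1 ≤ S.card := by
      rw [Nat.one_le_iff_ne_zero, Finset.card_ne_zero, Finset.nonempty_iff_ne_empty]
      rintro rfl
      simp only [covered, Finset.notMem_empty, false_and, exists_false, Finset.filter_false,
        Finset.card_empty] at hS
      omega
    rw [hobj, ← one_div_div]
    exact div_le_div_of_nonneg_right (by exact_mod_cast hS1) (by positivity)

end
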